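/- arXiv:1003.6016 — 2 statements merged into one kernel-verified Lean document; each statement's English description precedes it below -/
import Mathlib

section
/- Let d ≥ 3, let o ∈ {0,1}, and let s, r be integers with o ≤ s ≤ r ≤ r̄(d). Then there exists C > 0 such that for every smooth function a on ℝ^d with ‖a‖_{o,r−o,0} < ∞ and every Schwartz function u on ℝ^d: ‖a u‖_{H^{s−o}} ≤ C ‖a‖_{o,r−o,0} ‖u‖_{H^s}, where ‖v‖_{H^m} := Σ_{|α| ≤ m} ‖∂^α v‖_{L²} for integers m ≥ 0. (That is, multiplication by a behaves like a differential operator of order o.) -/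
open MeasureTheory Complex Finset
open scoped ENNReal

noncomputable section

abbrev Euc (d : ℕ) := EuclideanSpace ℝ (Fin d)

/-- Partial derivative `∂_j` of a complex-valued function on `ℝ^d`. -/
def pd {d : ℕ} (j : Fin d) (u : Euc d → ℂ) : Euc d → ℂ :=
  fun x => fderiv ℝ u x (EuclideanSpace.single j 1)

/-- Iterated partial derivative `∂^α` for a multi-index `α`. -/
def pdAlpha {d : ℕ} (α : Fin d → ℕ) (u : Euc d → ℂ) : Euc d → ℂ :=
  (List.finRange d).foldr (fun j v => (pd j)^[α j] v) u

/-- The Laplacian `Δ = Σ_j ∂_j²`. -/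
def lap {d : ℕ} (u : Euc d → ℂ) : Euc d → ℂ :=
  fun x => ∑ j, pd j (pd j u) x

/-- The operator `x·∇`. -/
def xGrad {d : ℕ} (u : Euc d → ℂ) : Euc d → ℂ :=
  fun x => ∑ j, (x j : ℂ) * pd j u x

/-- Multi-indices `α` on `Fin d` with `|α| ≤ r`. -/
def multiIndices (d r : ℕ) : Finset (Fin d → ℕ) :=
  (Fintype.piFinset fun _ : Fin d => Finset.range (r + 1)).filter
    (fun α => ∑ i, α i ≤ r)

/-- The norm `‖a‖_{o,r,N} = Σ_{n ≤ N, |α| ≤ r} ‖∂^α (x·∇)^n a‖_{L^{d/(o+|α|)}}`,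
with the convention `L^{d/0} = L^∞` (in `ℝ≥0∞`, `d/0 = ∞`). -/
def coefNorm (d o r N : ℕ) (a : Euc d → ℂ) : ℝ≥0∞ :=
  ∑ n ∈ Finset.range (N + 1), ∑ α ∈ multiIndices d r,
    eLpNorm (pdAlpha α ((xGrad (d := d))^[n] a))
      ((d : ℝ≥0∞) / ((o + ∑ i, α i : ℕ) : ℝ≥0∞)) volume

/-- The Sobolev norm `‖v‖_{H^m} = Σ_{|α| ≤ m} ‖∂^α v‖_{L²}`. -/
def sobNorm (d s : ℕ) (u : Euc d → ℂ) : ℝ≥0∞ :=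
  ∑ α ∈ multiIndices d s, eLpNorm (pdAlpha α u) 2 volume

/-- `D_j = -i ∂_j`. -/
def Dop {d : ℕ} (j : Fin d) (u : Euc d → ℂ) : Euc d → ℂ :=
  fun x => -Complex.I * pd j u x

/-- The operator `P u = Σ_{j,k} a_{jk} D_j D_k u + Σ_k b_k D_k u`. -/
def Pop {d : ℕ} (a : Fin d → Fin d → Euc d → ℂ) (b : Fin d → Euc d → ℂ)
    (u : Euc d → ℂ) : Euc d → ℂ :=
  fun x => (∑ j, ∑ k, a j k x * Dop j (Dop k u) x) + ∑ k, b k x * Dop k u x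

/-- The generator of dilations `A = (x·∇)/i + d/2`. -/
def Aop {d : ℕ} (u : Euc d → ℂ) : Euc d → ℂ :=
  fun x => -Complex.I * xGrad u x + ((d : ℂ) / 2) * u x

/-- Iterated commutators `ad_A^0 T = T`, `ad_A^{n+1} T = (ad_A^n T) A - A (ad_A^n T)`. -/
def adA {d : ℕ} : ℕ → ((Euc d → ℂ) → (Euc d → ℂ)) → ((Euc d → ℂ) → (Euc d → ℂ))
  | 0, T => T
  | n + 1, T => fun u x => adA n T (Aop u) x - Aop (adA n T u) x

/-- `P` is symmetric on Schwartz functions. -/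
def IsSymmP {d : ℕ} (a : Fin d → Fin d → Euc d → ℂ) (b : Fin d → Euc d → ℂ) : Prop :=
  ∀ u v : SchwartzMap (Euc d) ℂ,
    ∫ x, Pop a b u x * (starRingEnd ℂ) (v x) = ∫ x, u x * (starRingEnd ℂ) (Pop a b v x)

/-- Smooth with all derivatives bounded. -/
def CinftyBdd {d : ℕ} (f : Euc d → ℂ) : Prop :=
  ContDiff ℝ (⊤ : ℕ∞) f ∧ ∀ n : ℕ, ∃ C : ℝ, ∀ x, ‖iteratedFDeriv ℝ n f x‖ ≤ C

/-- `r̄(d)`: the largest integer strictly smaller than `d/2`. -/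
def rbar (d : ℕ) : ℕ := (d - 1) / 2

/-- `‖∇u‖_{L²} = (Σ_j ‖∂_j u‖_{L²}²)^{1/2}`. -/
def gradNorm {d : ℕ} (u : Euc d → ℂ) : ℝ≥0∞ :=
  (∑ j, eLpNorm (pd j u) 2 volume ^ 2) ^ (1 / 2 : ℝ)

/-- `‖∇u‖_{L²}²` as a real number, for Schwartz `u`. -/
def gradSq {d : ℕ} (u : Euc d → ℂ) : ℝ :=
  ∑ j, ∫ x, ‖pd j u x‖ ^ 2

/-- Japanese bracket `⟨x⟩ = (1+|x|²)^{1/2}`. -/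
def jap {d : ℕ} (x : Euc d) : ℝ := Real.sqrt (1 + ‖x‖ ^ 2)

namespace SobolevMul

/-- The exponent of the Sobolev embedding of `k` derivatives in `L²`, with `1/q = 1/2 - k/d`. -/
def sobolevExponent (d k : ℕ) : NNReal := ((2 : NNReal)⁻¹ - (k : NNReal) / d)⁻¹

/-- The iterated partial derivative along a list of directions. -/
def pdList {d : ℕ} (l : List (Fin d)) (u : Euc d → ℂ) : Euc d → ℂ := l.foldr pd u

section PartialDerivatives

variable {d : ℕ}

theorem pdList_append_singleton (l : List (Fin d)) (j : Fin d) (u : Euc d → ℂ) :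
    pdList (l ++ [j]) u = pdList l (pd j u) := by
  simp [pdList]

theorem contDiff_pd {u : Euc d → ℂ} (hu : ContDiff ℝ (⊤ : ℕ∞) u) (j : Fin d) :
    ContDiff ℝ (⊤ : ℕ∞) (pd j u) :=
  (hu.fderiv_right (m := (⊤ : ℕ∞)) (by simp)).clm_apply contDiff_const

theorem contDiff_pdList {u : Euc d → ℂ} (hu : ContDiff ℝ (⊤ : ℕ∞) u) (l : List (Fin d)) :
    ContDiff ℝ (⊤ : ℕ∞) (pdList l u) := by
  induction l with
  | nil => exact hu
  | cons j l ih => exact contDiff_pd ih j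

theorem pd_comm {u : Euc d → ℂ} (hu : ContDiff ℝ (⊤ : ℕ∞) u) (i j : Fin d) :
    pd i (pd j u) = pd j (pd i u) := by
  have hdiff : Differentiable ℝ (fderiv ℝ u) :=
    (hu.fderiv_right (m := (⊤ : ℕ∞)) (by simp)).differentiable (by simp)
  have key : ∀ (i j : Fin d) (x : Euc d), pd i (pd j u) x =
      fderiv ℝ (fderiv ℝ u) x (EuclideanSpace.single i 1) (EuclideanSpace.single j 1) := by
    intro i j x
    unfold pd
    rw [fderiv_clm_apply (hdiff x) (differentiableAt_const _)]
    simp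
  ext x
  rw [key, key]
  have hsymm : IsSymmSndFDerivAt ℝ u x := hu.contDiffAt.isSymmSndFDerivAt (by
    rw [minSmoothness_of_isRCLikeNormedField]
    exact WithTop.coe_le_coe.2 (le_top : (2 : ℕ∞) ≤ ⊤))
  exact hsymm.eq _ _

theorem pdList_perm {u : Euc d → ℂ} (hu : ContDiff ℝ (⊤ : ℕ∞) u) {l l' : List (Fin d)}
    (h : l.Perm l') : pdList l u = pdList l' u := by
  induction h with
  | nil => rfl
  | cons j _ ih => exact congrArg (pd j) ih
  | swap i j l => exact pd_comm (contDiff_pdList hu l) _ _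
  | trans _ _ ih₁ ih₂ => exact ih₁.trans ih₂

/-- The nondecreasing list of directions with multiplicities prescribed by `α`. -/
def directions (α : Fin d → ℕ) : List (Fin d) :=
  (List.finRange d).flatMap fun j => List.replicate (α j) j

theorem pdAlpha_eq_pdList (α : Fin d → ℕ) (u : Euc d → ℂ) :
    pdAlpha α u = pdList (directions α) u := by
  unfold pdAlpha pdList directions
  have hrep : ∀ (n : ℕ) (j : Fin d) (v : Euc d → ℂ),
      (List.replicate n j).foldr pd v = (pd j)^[n] v := by
    intro n j v
    induction n with
    | zero => rfl
    | succ n ih => rw [List.replicate_succ, List.foldr_cons, ih, Function.iterate_succ_apply']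
  induction List.finRange d with
  | nil => rfl
  | cons j l ih => rw [List.foldr_cons, ih, List.flatMap_cons, List.foldr_append, hrep]

theorem count_directions (α : Fin d → ℕ) (j : Fin d) : (directions α).count j = α j := by
  simp only [directions, List.count_flatMap, Function.comp_def, List.count_replicate]
  rw [← List.ofFn_eq_map, List.sum_ofFn]
  simp

theorem length_directions (α : Fin d → ℕ) : (directions α).length = ∑ j, α j := by
  simp only [directions, List.length_flatMap, List.length_replicate]
  rw [← List.ofFn_eq_map, List.sum_ofFn]

theorem pdList_eq_pdAlpha {u : Euc d → ℂ} (hu : ContDiff ℝ (⊤ : ℕ∞) u) (l : List (Fin d)) :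
    pdList l u = pdAlpha (fun j => l.count j) u := by
  rw [pdAlpha_eq_pdList]
  refine pdList_perm hu (List.perm_iff_count.2 fun j => ?_)
  rw [count_directions]

theorem sum_count_eq_length (l : List (Fin d)) : ∑ j, l.count j = l.length := by
  rw [← length_directions]
  exact (List.perm_iff_count.2 fun j => by rw [count_directions]).length_eq

theorem mem_multiIndices {r : ℕ} {α : Fin d → ℕ} : α ∈ multiIndices d r ↔ ∑ i, α i ≤ r := by
  simp only [multiIndices, Finset.mem_filter, Fintype.mem_piFinset, Finset.mem_range,
    and_iff_right_iff_imp]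
  intro h i
  have := Finset.single_le_sum (f := α) (fun _ _ => Nat.zero_le _) (Finset.mem_univ i)
  omega

theorem count_mem_multiIndices {r : ℕ} {l : List (Fin d)} (hl : l.length ≤ r) :
    (fun j => l.count j) ∈ multiIndices d r :=
  mem_multiIndices.2 (by rwa [sum_count_eq_length])

theorem eLpNorm_pdList_le_sobNorm {u : Euc d → ℂ} (hu : ContDiff ℝ (⊤ : ℕ∞) u)
    {s : ℕ} {l : List (Fin d)} (hl : l.length ≤ s) :
    eLpNorm (pdList l u) 2 volume ≤ sobNorm d s u := by
  rw [pdList_eq_pdAlpha hu]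
  exact Finset.single_le_sum (f := fun α => eLpNorm (pdAlpha α u) 2 volume)
    (fun _ _ => zero_le) (count_mem_multiIndices hl)

theorem eLpNorm_pdList_le_coefNorm {a : Euc d → ℂ} (ha : ContDiff ℝ (⊤ : ℕ∞) a)
    {o r : ℕ} {l : List (Fin d)} (hl : l.length ≤ r) :
    eLpNorm (pdList l a) ((d : ℝ≥0∞) / ((o + l.length : ℕ) : ℝ≥0∞)) volume ≤
      coefNorm d o r 0 a := by
  rw [pdList_eq_pdAlpha ha, ← sum_count_eq_length]
  simp only [coefNorm, zero_add, Finset.sum_range_one, Function.iterate_zero, id_eq]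
  exact Finset.single_le_sum (f := fun α => eLpNorm (pdAlpha α a)
    ((d : ℝ≥0∞) / ((o + ∑ i, α i : ℕ) : ℝ≥0∞)) volume)
    (fun _ _ => zero_le) (count_mem_multiIndices hl)

theorem pd_mul {a u : Euc d → ℂ} (ha : ContDiff ℝ (⊤ : ℕ∞) a) (hu : ContDiff ℝ (⊤ : ℕ∞) u)
    (j : Fin d) : pd j (a * u) = pd j a * u + a * pd j u := by
  ext x
  have h := fderiv_mul (ha.differentiable (by simp) x) (hu.differentiable (by simp) x)
  calc pd j (a * u) x = a x * pd j u x + u x * pd j a x :=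
        congrArg (fun L : Euc d →L[ℝ] ℂ => L (EuclideanSpace.single j 1)) h
    _ = pd j a x * u x + a x * pd j u x := by ring

theorem pd_add {a u : Euc d → ℂ} (ha : ContDiff ℝ (⊤ : ℕ∞) a) (hu : ContDiff ℝ (⊤ : ℕ∞) u)
    (j : Fin d) : pd j (a + u) = pd j a + pd j u := by
  ext x
  simp only [pd]
  rw [fderiv_add (ha.differentiable (by simp) x) (hu.differentiable (by simp) x)]
  rfl

theorem pdList_add {a u : Euc d → ℂ} (ha : ContDiff ℝ (⊤ : ℕ∞) a)
    (hu : ContDiff ℝ (⊤ : ℕ∞) u) (l : List (Fin d)) :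
    pdList l (a + u) = pdList l a + pdList l u := by
  induction l with
  | nil => rfl
  | cons j l ih =>
    change pd j (pdList l (a + u)) = _
    rw [ih, pd_add (contDiff_pdList ha l) (contDiff_pdList hu l)]
    rfl

/-- A quantitative Leibniz rule: uniform bounds on the products of derivatives of total order
at most `m` control the derivatives of a product. -/
theorem eLpNorm_pdList_mul_le {a u : Euc d → ℂ} (ha : ContDiff ℝ (⊤ : ℕ∞) a)
    (hu : ContDiff ℝ (⊤ : ℕ∞) u) {m : ℕ} {M : ℝ≥0∞}
    (hM : ∀ l₁ l₂ : List (Fin d), l₁.length + l₂.length ≤ m →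
      eLpNorm (pdList l₁ a * pdList l₂ u) 2 volume ≤ M) (l : List (Fin d)) :
    ∀ l₁ l₂ : List (Fin d), l.length + l₁.length + l₂.length ≤ m →
      eLpNorm (pdList l (pdList l₁ a * pdList l₂ u)) 2 volume ≤ 2 ^ l.length * M := by
  induction l using List.reverseRecOn with
  | nil =>
    intro l₁ l₂ h
    simpa [pdList] using hM l₁ l₂ (by simpa using h)
  | append_singleton l j ih =>
    intro l₁ l₂ h
    simp only [List.length_append, List.length_singleton] at h
    have h₁ := contDiff_pdList ha l₁
    have h₂ := contDiff_pdList hu l₂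
    have h₃ : ContDiff ℝ (⊤ : ℕ∞) (pd j (pdList l₁ a) * pdList l₂ u) := (contDiff_pd h₁ j).mul h₂
    have h₄ : ContDiff ℝ (⊤ : ℕ∞) (pdList l₁ a * pd j (pdList l₂ u)) := h₁.mul (contDiff_pd h₂ j)
    rw [pdList_append_singleton, pd_mul h₁ h₂, pdList_add h₃ h₄]
    calc _ ≤ _ := eLpNorm_add_le (contDiff_pdList h₃ l).continuous.aestronglyMeasurable
            (contDiff_pdList h₄ l).continuous.aestronglyMeasurable (by norm_num)
      _ ≤ 2 ^ l.length * M + 2 ^ l.length * M :=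
          add_le_add (ih (j :: l₁) l₂ (by simp only [List.length_cons]; omega))
            (ih l₁ (j :: l₂) (by simp only [List.length_cons]; omega))
      _ = _ := by
          rw [List.length_append, List.length_singleton, pow_succ]
          ring

theorem coe_lineDerivOp_single (v : SchwartzMap (Euc d) ℂ) (j : Fin d) :
    ⇑(LineDeriv.lineDerivOp (EuclideanSpace.single j (1 : ℝ)) v) = pd j v := by
  ext x
  exact SchwartzMap.lineDerivOp_apply_eq_fderiv _ v x

theorem exists_schwartz_eq_pdList (v : SchwartzMap (Euc d) ℂ) (l : List (Fin d)) :
    ∃ w : SchwartzMap (Euc d) ℂ, ⇑w = pdList l v := by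
  induction l with
  | nil => exact ⟨v, rfl⟩
  | cons j l ih =>
    obtain ⟨w, hw⟩ := ih
    exact ⟨_, (coe_lineDerivOp_single w j).trans (congrArg (pd j) hw)⟩

end PartialDerivatives

section Sobolev

open Filter Topology

variable {d : ℕ}

/-- The **Gagliardo-Nirenberg-Sobolev inequality** for Schwartz functions. -/
theorem eLpNorm_le_eLpNorm_fderiv_schwartz (hd : 0 < d) {p p' : NNReal} (hp : 1 ≤ p)
    (hp' : (p' : ℝ)⁻¹ = (p : ℝ)⁻¹ - (d : ℝ)⁻¹) (v : SchwartzMap (Euc d) ℂ) :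
    eLpNorm v p' volume ≤
      SNormLESNormFDerivOfEqConst ℂ (volume : Measure (Euc d)) p *
        eLpNorm (fderiv ℝ v) p volume := by
  set K := SNormLESNormFDerivOfEqConst ℂ (volume : Measure (Euc d)) p
  let χ : ContDiffBump (0 : Euc d) := ⟨1, 2, by norm_num, by norm_num⟩
  have hχ : ContDiff ℝ 1 χ := χ.contDiff
  obtain ⟨B, hB⟩ := (χ.hasCompactSupport.fderiv (𝕜 := ℝ)).exists_bound_of_continuous
    (hχ.continuous_fderiv (by simp))
  let c : ℕ → ℝ := fun n => 1 / ((n : ℝ) + 1)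
  have hc : Tendsto c atTop (𝓝 0) := tendsto_one_div_add_atTop_nhds_zero_nat
  have hcpos : ∀ n, 0 < c n := fun n => by positivity
  let f : ℕ → Euc d → ℂ := fun n x => χ (c n • x) • v x
  have hψ : ∀ n, ContDiff ℝ 1 fun x : Euc d => χ (c n • x) :=
    fun n => hχ.comp (contDiff_const_smul _)
  have hf : ∀ n, ContDiff ℝ 1 (f n) := fun n => (hψ n).smul (v.smooth 1)
  have hfc : ∀ n, HasCompactSupport (f n) := fun n =>
    (χ.hasCompactSupport.comp_homeomorph
      (Homeomorph.smulOfNeZero (c n) (hcpos n).ne')).smul_right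
  have hlim : ∀ x, Tendsto (fun n => f n x) atTop (𝓝 (v x)) := by
    intro x
    have h0 : Tendsto (fun n => χ (c n • x)) atTop (𝓝 (χ 0)) :=
      (χ.continuous.tendsto 0).comp (by simpa using hc.smul_const x)
    have h1 : χ (0 : Euc d) = 1 := χ.one_of_mem_closedBall (by simp [χ])
    rw [h1] at h0
    have h2 := h0.smul_const (v x)
    rwa [one_smul] at h2
  have hbound : ∀ n x, ‖fderiv ℝ (f n) x‖ ≤ ‖‖fderiv ℝ v x‖ + (c n * B) * ‖v x‖‖ := by
    intro n x
    have hB0 : 0 ≤ B := (norm_nonneg _).trans (hB 0)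
    rw [Real.norm_of_nonneg (by have := (hcpos n).le; positivity)]
    have hψx : DifferentiableAt ℝ (fun x : Euc d => χ (c n • x)) x :=
      (hψ n).differentiable (by simp) x
    have hfd : fderiv ℝ (f n) x = χ (c n • x) • fderiv ℝ v x +
        (fderiv ℝ (fun x : Euc d => χ (c n • x)) x).smulRight (v x) :=
      fderiv_fun_smul hψx v.differentiableAt
    rw [hfd]
    refine (norm_add_le _ _).trans (add_le_add ?_ ?_)
    · rw [norm_smul, Real.norm_of_nonneg χ.nonneg]
      exact mul_le_of_le_one_left (norm_nonneg _) χ.le_one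
    · rw [ContinuousLinearMap.norm_smulRight_apply]
      gcongr
      rw [fderiv_comp_smul, norm_smul, Real.norm_of_nonneg (hcpos n).le]
      exact mul_le_mul_of_nonneg_left (hB _) (hcpos n).le
  have hGNS : ∀ n, eLpNorm (f n) p' volume ≤
      K * (eLpNorm (fderiv ℝ v) p volume + ‖c n * B‖ₑ * eLpNorm v p volume) := by
    intro n
    have hcont : Continuous (fderiv ℝ v) := (v.smooth 1).continuous_fderiv (by simp)
    refine (eLpNorm_le_eLpNorm_fderiv_of_eq volume (hf n) (hfc n) hp (by simpa using hd)
      (by simpa using hp')).trans ?_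
    refine mul_le_mul_right ?_ _
    refine (eLpNorm_mono (hbound n)).trans ?_
    refine (eLpNorm_add_le hcont.norm.aestronglyMeasurable
      (v.continuous.norm.const_smul (c n * B)).aestronglyMeasurable (by exact_mod_cast hp)).trans ?_
    refine add_le_add (eLpNorm_norm _).le ?_
    refine (eLpNorm_const_smul_le (c := c n * B) (f := fun x => ‖v x‖)).trans ?_
    rw [eLpNorm_norm]
  have hRHS : Tendsto (fun n => (K : ℝ≥0∞) *
      (eLpNorm (fderiv ℝ v) p volume + ‖c n * B‖ₑ * eLpNorm v p volume)) atTop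
      (𝓝 (K * eLpNorm (fderiv ℝ v) p volume)) := by
    have h1 : Tendsto (fun n => ‖c n * B‖ₑ) atTop (𝓝 0) := by
      simpa using (hc.mul_const B).enorm
    have hL : eLpNorm v p volume ≠ ⊤ := (v.memLp p volume).eLpNorm_ne_top
    generalize eLpNorm v p volume = L at hL ⊢
    generalize eLpNorm (fderiv ℝ v) p volume = G
    have h2 : Tendsto (fun n => ‖c n * B‖ₑ * L) atTop (𝓝 0) := by
      simpa using ENNReal.Tendsto.mul_const h1 (Or.inr hL)
    have h3 : Tendsto (fun n => G + ‖c n * B‖ₑ * L) atTop (𝓝 G) := by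
      simpa using tendsto_const_nhds.add h2
    exact ENNReal.Tendsto.const_mul h3 (Or.inr ENNReal.coe_ne_top)
  calc eLpNorm v p' volume ≤ liminf (fun n => eLpNorm (f n) p' volume) atTop :=
        Lp.eLpNorm_lim_le_liminf_eLpNorm
          (fun n => (hf n).continuous.aestronglyMeasurable) _ (ae_of_all _ hlim)
    _ ≤ liminf (fun n => (K : ℝ≥0∞) *
      (eLpNorm (fderiv ℝ v) p volume + ‖c n * B‖ₑ * eLpNorm v p volume)) atTop :=
        liminf_le_liminf (Eventually.of_forall hGNS)
    _ = _ := hRHS.liminf_eq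

theorem norm_fderiv_le_sum_pd (u : Euc d → ℂ) (x : Euc d) :
    ‖fderiv ℝ u x‖ ≤ ∑ j, ‖pd j u x‖ := by
  refine ContinuousLinearMap.opNorm_le_bound _ (by positivity) fun y => ?_
  have hy : y = ∑ j, y j • EuclideanSpace.single j (1 : ℝ) := by
    simpa using ((EuclideanSpace.basisFun (Fin d) ℝ).sum_repr y).symm
  conv_lhs => rw [hy]
  rw [map_sum, Finset.sum_mul]
  refine (norm_sum_le _ _).trans (Finset.sum_le_sum fun j _ => ?_)
  rw [map_smul, norm_smul, mul_comm]
  exact mul_le_mul_of_nonneg_left (PiLp.norm_apply_le y j) (norm_nonneg _)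

theorem sobolevExponent_inv_coe {k : ℕ} (hk : 2 * k < d) :
    ((sobolevExponent d k : ℝ))⁻¹ = 2⁻¹ - (k : ℝ) / d := by
  have hd : (0 : ℝ) < d := by exact_mod_cast (by omega : 0 < d)
  have h2 : (2 * k : ℝ) < d := by exact_mod_cast hk
  have hle : (k : NNReal) / d ≤ 2⁻¹ := by
    rw [← NNReal.coe_le_coe]
    push_cast
    rw [div_le_iff₀ hd]
    linarith
  rw [sobolevExponent, NNReal.coe_inv, inv_inv, NNReal.coe_sub hle]
  push_cast
  rfl

theorem sobolevExponent_inv_pos {k : ℕ} (hk : 2 * k < d) :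
    0 < ((sobolevExponent d k : ℝ))⁻¹ := by
  have hd : (0 : ℝ) < d := by exact_mod_cast (by omega : 0 < d)
  have h2 : (2 * k : ℝ) < d := by exact_mod_cast hk
  rw [sobolevExponent_inv_coe hk, sub_pos, div_lt_iff₀ hd]
  linarith

theorem one_le_sobolevExponent {k : ℕ} (hk : 2 * k < d) : 1 ≤ sobolevExponent d k := by
  have hpos := sobolevExponent_inv_pos hk
  have hle : ((sobolevExponent d k : ℝ))⁻¹ ≤ 1 := by
    rw [sobolevExponent_inv_coe hk]
    have : (0 : ℝ) ≤ (k : ℝ) / d := by positivity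
    linarith
  rw [← NNReal.coe_le_coe]
  exact (inv_le_one₀ (inv_pos.1 hpos)).1 hle

/-- The homogeneous Sobolev embedding `Ḣ^k ⊆ L^q` with `1/q = 1/2 - k/d` on Schwartz functions. -/
theorem exists_sobolev_const (k : ℕ) (hk : 2 * k < d) :
    ∃ C : NNReal, ∀ (v : SchwartzMap (Euc d) ℂ) (M : ℝ≥0∞),
      (∀ l : List (Fin d), l.length = k → eLpNorm (pdList l v) 2 volume ≤ M) →
        eLpNorm v (sobolevExponent d k) volume ≤ C * M := by
  induction k with
  | zero =>
    refine ⟨1, fun v M h => ?_⟩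
    simpa [sobolevExponent, pdList] using h [] rfl
  | succ k ih =>
    obtain ⟨C, hC⟩ := ih (by omega)
    have hd : (d : ℝ) ≠ 0 := by exact_mod_cast (by omega : d ≠ 0)
    have hp := one_le_sobolevExponent (d := d) (k := k) (by omega)
    refine ⟨SNormLESNormFDerivOfEqConst ℂ (volume : Measure (Euc d)) (sobolevExponent d k) *
      (d * C), fun v M h => ?_⟩
    have hstep := eLpNorm_le_eLpNorm_fderiv_schwartz (by omega : 0 < d) hp
      (p' := sobolevExponent d (k + 1)) (by
        rw [sobolevExponent_inv_coe hk, sobolevExponent_inv_coe (by omega)]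
        push_cast
        ring) v
    refine hstep.trans ?_
    rw [ENNReal.coe_mul, mul_assoc]
    refine mul_le_mul_right ?_ _
    have hpd : ∀ j : Fin d, eLpNorm (pd j v) (sobolevExponent d k) volume ≤ C * M := by
      intro j
      rw [← coe_lineDerivOp_single]
      refine hC _ M fun l hl => ?_
      rw [coe_lineDerivOp_single, ← pdList_append_singleton]
      exact h _ (by simp [hl])
    calc eLpNorm (fderiv ℝ v) (sobolevExponent d k) volume
        ≤ eLpNorm (∑ j, fun x => ‖pd j v x‖) (sobolevExponent d k) volume := by
          refine eLpNorm_mono_real fun x => ?_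
          simpa using norm_fderiv_le_sum_pd v x
      _ ≤ ∑ j, eLpNorm (fun x => ‖pd j v x‖) (sobolevExponent d k) volume :=
          eLpNorm_sum_le
            (fun j _ => (contDiff_pd (v.smooth _) j).continuous.norm.aestronglyMeasurable)
            (by exact_mod_cast hp)
      _ ≤ ∑ _j : Fin d, C * M := Finset.sum_le_sum fun j _ => by
          rw [eLpNorm_norm]
          exact hpd j
      _ = _ := by
          simp [mul_assoc]

theorem holderTriple_sobolevExponent {k : ℕ} (hk : 2 * k < d) :
    ENNReal.HolderTriple ((d : ℝ≥0∞) / (k : ℝ≥0∞)) (sobolevExponent d k) 2 := by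
  refine ⟨?_⟩
  have hd : (d : NNReal) ≠ 0 := by exact_mod_cast (by omega : d ≠ 0)
  have hq : sobolevExponent d k ≠ 0 := (zero_lt_one.trans_le (one_le_sobolevExponent hk)).ne'
  rw [ENNReal.inv_div (Or.inl (by simp)) (Or.inr (by exact_mod_cast hd)), ← ENNReal.coe_inv hq]
  have h : (k : NNReal) / d + (sobolevExponent d k)⁻¹ = 2⁻¹ := by
    rw [← NNReal.coe_inj]
    push_cast
    rw [sobolevExponent_inv_coe hk]
    ring
  have h' : (((k : NNReal) / d + (sobolevExponent d k)⁻¹ : NNReal) : ℝ≥0∞) =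
      ((2⁻¹ : NNReal) : ℝ≥0∞) := by rw [h]
  rw [ENNReal.coe_add, ENNReal.coe_div hd, ENNReal.coe_inv two_ne_zero] at h'
  simpa using h'

end Sobolev

end SobolevMul

open SobolevMul in
/-- For `o ∈ {0,1}` and integers `o ≤ s ≤ r ≤ r̄(d)`, multiplication by `a`
behaves like a differential operator of order `o`:
`‖a u‖_{H^{s-o}} ≤ C ‖a‖_{o,r-o,0} ‖u‖_{H^s}`. -/
theorem statement11 (d : ℕ) (hd : 3 ≤ d) (o s r : ℕ) (ho : o ≤ 1)
    (hos : o ≤ s) (hsr : s ≤ r) (hr : r ≤ rbar d) :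
    ∃ C : ℝ, 0 < C ∧
      ∀ a : Euc d → ℂ, ContDiff ℝ (⊤ : ℕ∞) a → coefNorm d o (r - o) 0 a ≠ ⊤ →
        ∀ u : SchwartzMap (Euc d) ℂ,
          sobNorm d (s - o) (fun x => a x * u x) ≤
            ENNReal.ofReal C * coefNorm d o (r - o) 0 a * sobNorm d s ⇑u := by
  have hd0 : 2 * r < d := by
    unfold rbar at hr
    omega
  choose! K hK using fun k (hk : 2 * k < d) => exists_sobolev_const (d := d) k hk
  let C₀ : NNReal := ∑ k ∈ Finset.range (s + 1), K k
  let C : NNReal := (multiIndices d (s - o)).card * (2 ^ (s - o) * C₀) + 1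
  refine ⟨C, by positivity, fun a ha _ u => ?_⟩
  rw [ENNReal.ofReal_coe_nnreal]
  have hu : ContDiff ℝ (⊤ : ℕ∞) u := u.smooth _
  set A := coefNorm d o (r - o) 0 a
  set S := sobNorm d s u
  have hprod : ∀ l₁ l₂ : List (Fin d), l₁.length + l₂.length ≤ s - o →
      eLpNorm (pdList l₁ a * pdList l₂ u) 2 volume ≤ C₀ * A * S := by
    intro l₁ l₂ h
    have hk : 2 * (o + l₁.length) < d := by omega
    obtain ⟨w, hw⟩ := exists_schwartz_eq_pdList u l₂
    have hsob : eLpNorm (pdList l₂ u) (sobolevExponent d (o + l₁.length)) volume ≤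
        K (o + l₁.length) * S := by
      rw [← hw]
      refine hK _ hk w S fun l hl => ?_
      have happ : pdList l w = pdList (l ++ l₂) u := by
        rw [hw]
        simp [pdList]
      rw [happ]
      exact eLpNorm_pdList_le_sobNorm hu (by rw [List.length_append]; omega)
    have hKC : K (o + l₁.length) ≤ C₀ :=
      Finset.single_le_sum (f := K) (fun _ _ => zero_le) (Finset.mem_range.2 (by omega))
    have := holderTriple_sobolevExponent hk
    calc _ ≤ eLpNorm (pdList l₁ a) ((d : ℝ≥0∞) / ((o + l₁.length : ℕ) : ℝ≥0∞)) volume *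
          eLpNorm (pdList l₂ u) (sobolevExponent d (o + l₁.length)) volume :=
          eLpNorm_smul_le_mul_eLpNorm
            (contDiff_pdList hu l₂).continuous.aestronglyMeasurable
            (contDiff_pdList ha l₁).continuous.aestronglyMeasurable
      _ ≤ A * (C₀ * S) := mul_le_mul' (eLpNorm_pdList_le_coefNorm ha (by omega))
          (hsob.trans (by gcongr))
      _ = _ := by ring
  have hα : ∀ α ∈ multiIndices d (s - o), eLpNorm (pdAlpha α fun x => a x * u x) 2 volume ≤
      2 ^ (s - o) * (C₀ * A * S) := by
    intro α hα
    rw [mem_multiIndices, ← length_directions] at hα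
    rw [pdAlpha_eq_pdList]
    refine (eLpNorm_pdList_mul_le ha hu hprod (directions α) [] [] (by simpa using hα)).trans ?_
    gcongr
    norm_num
  calc sobNorm d (s - o) (fun x => a x * u x)
      ≤ ∑ _α ∈ multiIndices d (s - o), 2 ^ (s - o) * (C₀ * A * S) := Finset.sum_le_sum hα
    _ = ((multiIndices d (s - o)).card * (2 ^ (s - o) * C₀) : NNReal) * A * S := by
        rw [Finset.sum_const, nsmul_eq_mul]
        push_cast
        ring
    _ ≤ C * A * S := by
        gcongr
        exact le_self_add
end
end

section
/- Let d ≥ 3, set r = r̄(d), and let n ≥ 0 and 1 ≤ s ≤ r be integers. Then there exists C > 0 such that for every operator P u = Σ_{j,k} a_{jk}(x) D_j D_k u + Σ_k b_k(x) D_k u with smooth coefficients satisfying ‖a_{jk} − δ_{jk}‖_{0,r,n} < ∞ and ‖b_k‖_{1,r−1,n} < ∞, and every Schwartz function u: ‖ad_A^n (P + Δ) u‖_{H^{s−1}} ≤ C (Σ_{j,k} ‖a_{jk} − δ_{jk}‖_{0,r,n} + Σ_k ‖b_k‖_{1,r−1,n}) ‖u‖_{H^{s+1}}, where ad_A⁰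 Q = Q and ad_A^n Q = (ad_A^{n−1} Q)A − A(ad_A^{n−1} Q) are iterated commutators with the dilation generator A = (x·∇)/i + d/2, computed as differential operators on Schwartz functions, and ‖v‖_{H^m} := Σ_{|α| ≤ m} ‖∂^α v‖_{L²}. -/
open MeasureTheory Complex Finset
open scoped ENNReal

noncomputable section

/-- The iterated partial derivative along a list of directions, the head being applied first. -/
def pdList {d : ℕ} : List (Fin d) → (Euc d → ℂ) → (Euc d → ℂ)
  | [], u => u
  | j :: l, u => pdList l (pd j u)

/-- The coefficient of `∂^β`, `|β| = q`, in the commutator of `c ∂^β` with `A`. -/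
def commCoef {d : ℕ} (q : ℕ) (c : Euc d → ℂ) : Euc d → ℂ :=
  fun x => -Complex.I * ((q : ℂ) * c x - xGrad c x)

section Calculus

variable {d : ℕ}

theorem ContDiff.pd {f : Euc d → ℂ} (hf : ContDiff ℝ (⊤ : ℕ∞) f) (j : Fin d) :
    ContDiff ℝ (⊤ : ℕ∞) (pd j f) :=
  (hf.fderiv_right (m := (⊤ : ℕ∞)) (by simp)).clm_apply contDiff_const

theorem ContDiff.pdList {f : Euc d → ℂ} (hf : ContDiff ℝ (⊤ : ℕ∞) f) (l : List (Fin d)) :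
    ContDiff ℝ (⊤ : ℕ∞) (pdList l f) := by
  induction l generalizing f with
  | nil => exact hf
  | cons j l ih => exact ih (hf.pd j)

theorem contDiff_coord (j : Fin d) : ContDiff ℝ (⊤ : ℕ∞) (fun x : Euc d => ((x j : ℝ) : ℂ)) :=
  Complex.ofRealCLM.contDiff.comp (EuclideanSpace.proj (𝕜 := ℝ) j).contDiff

theorem ContDiff.xGrad {f : Euc d → ℂ} (hf : ContDiff ℝ (⊤ : ℕ∞) f) :
    ContDiff ℝ (⊤ : ℕ∞) (xGrad f) :=
  ContDiff.sum fun j _ => (contDiff_coord j).mul (hf.pd j)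

theorem ContDiff.aop {f : Euc d → ℂ} (hf : ContDiff ℝ (⊤ : ℕ∞) f) :
    ContDiff ℝ (⊤ : ℕ∞) (Aop f) :=
  (contDiff_const.mul hf.xGrad).add (contDiff_const.mul hf)

theorem ContDiff.commCoef {f : Euc d → ℂ} (hf : ContDiff ℝ (⊤ : ℕ∞) f) (q : ℕ) :
    ContDiff ℝ (⊤ : ℕ∞) (commCoef q f) :=
  contDiff_const.mul ((contDiff_const.mul hf).sub hf.xGrad)

theorem ContDiff.iterate_commCoef {f : Euc d → ℂ} (hf : ContDiff ℝ (⊤ : ℕ∞) f) (q n : ℕ) :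
    ContDiff ℝ (⊤ : ℕ∞) ((_root_.commCoef q)^[n] f) := by
  induction n generalizing f with
  | zero => exact hf
  | succ n ih => exact ih (hf.commCoef q)

theorem ContDiff.differentiable_top {f : Euc d → ℂ} (hf : ContDiff ℝ (⊤ : ℕ∞) f) :
    Differentiable ℝ f :=
  hf.differentiable (by simp)

theorem pd_add {f g : Euc d → ℂ} (hf : Differentiable ℝ f) (hg : Differentiable ℝ g)
    (j : Fin d) : pd j (fun x => f x + g x) = fun x => pd j f x + pd j g x := by
  ext x
  simp only [pd]
  rw [fderiv_fun_add (hf x) (hg x)]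
  rfl

theorem pd_sub {f g : Euc d → ℂ} (hf : Differentiable ℝ f) (hg : Differentiable ℝ g)
    (j : Fin d) : pd j (fun x => f x - g x) = fun x => pd j f x - pd j g x := by
  ext x
  simp only [pd]
  rw [fderiv_fun_sub (hf x) (hg x)]
  rfl

theorem pd_mul {f g : Euc d → ℂ} (hf : Differentiable ℝ f) (hg : Differentiable ℝ g)
    (j : Fin d) : pd j (fun x => f x * g x) = fun x => pd j f x * g x + f x * pd j g x := by
  ext x
  simp only [pd]
  rw [fderiv_fun_mul (hf x) (hg x)]
  simp [mul_comm, add_comm]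

theorem pd_const_mul {f : Euc d → ℂ} (hf : Differentiable ℝ f) (c : ℂ) (j : Fin d) :
    pd j (fun x => c * f x) = fun x => c * pd j f x := by
  ext x
  simp only [pd]
  rw [fderiv_const_mul (hf x)]
  rfl

theorem pd_sum {ι : Type*} (s : Finset ι) {f : ι → Euc d → ℂ}
    (hf : ∀ i, Differentiable ℝ (f i)) (j : Fin d) :
    pd j (fun x => ∑ i ∈ s, f i x) = fun x => ∑ i ∈ s, pd j (f i) x := by
  ext x
  simp only [pd]
  rw [fderiv_fun_sum (fun i _ => hf i x)]
  simp

theorem pd_coord (j k : Fin d) :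
    pd j (fun x : Euc d => ((x k : ℝ) : ℂ)) = fun _ => if k = j then 1 else 0 := by
  ext x
  have h : HasFDerivAt (fun x : Euc d => ((x k : ℝ) : ℂ))
      (Complex.ofRealCLM.comp (EuclideanSpace.proj (𝕜 := ℝ) k)) x :=
    (Complex.ofRealCLM.comp (EuclideanSpace.proj (𝕜 := ℝ) k)).hasFDerivAt
  simp only [pd]
  rw [h.fderiv]
  by_cases hkj : k = j <;> simp [hkj]

theorem pd_comm {f : Euc d → ℂ} (hf : ContDiff ℝ (⊤ : ℕ∞) f) (j k : Fin d) :
    pd j (pd k f) = pd k (pd j f) := by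
  have key : ∀ (i l : Fin d) (x : Euc d), pd i (pd l f) x =
      fderiv ℝ (fderiv ℝ f) x (EuclideanSpace.single i 1) (EuclideanSpace.single l 1) := by
    intro i l x
    have h : Differentiable ℝ (fderiv ℝ f) :=
      (hf.fderiv_right (m := (⊤ : ℕ∞)) (by simp)).differentiable (by simp)
    unfold pd
    rw [fderiv_clm_apply (h x) (differentiableAt_const _)]
    simp
  ext x
  rw [key, key]
  refine (hf.contDiffAt.isSymmSndFDerivAt ?_).eq _ _
  rw [minSmoothness_of_isRCLikeNormedField]
  exact WithTop.coe_le_coe.2 (show (2 : ℕ∞) ≤ ⊤ from le_top)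

theorem xGrad_pd {f : Euc d → ℂ} (hf : ContDiff ℝ (⊤ : ℕ∞) f) (j : Fin d) :
    pd j (xGrad f) = fun x => xGrad (pd j f) x + pd j f x := by
  have h1 : pd j (xGrad f) = fun x => ∑ k, pd j (fun y => (y k : ℂ) * pd k f y) x :=
    pd_sum _ (fun k => ((contDiff_coord k).mul (hf.pd k)).differentiable_top) j
  rw [h1]
  ext x
  simp only [pd_mul (contDiff_coord _).differentiable_top (hf.pd _).differentiable_top, pd_coord,
    sum_add_distrib, xGrad, pd_comm hf j]
  simp [add_comm]

theorem pd_aop {f : Euc d → ℂ} (hf : ContDiff ℝ (⊤ : ℕ∞) f) (j : Fin d) :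
    pd j (Aop f) = fun x => Aop (pd j f) x + -Complex.I * pd j f x := by
  unfold Aop
  rw [pd_add (contDiff_const.mul hf.xGrad).differentiable_top
    (contDiff_const.mul hf).differentiable_top, pd_const_mul hf.xGrad.differentiable_top,
    pd_const_mul hf.differentiable_top, xGrad_pd hf]
  ext x
  ring

theorem xGrad_mul {f g : Euc d → ℂ} (hf : Differentiable ℝ f) (hg : Differentiable ℝ g) :
    xGrad (fun x => f x * g x) = fun x => xGrad f x * g x + f x * xGrad g x := by
  ext x
  simp only [xGrad, pd_mul hf hg, sum_mul, mul_sum, ← sum_add_distrib]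
  exact sum_congr rfl fun j _ => by ring

theorem xGrad_const_mul {f : Euc d → ℂ} (hf : Differentiable ℝ f) (c : ℂ) :
    xGrad (fun x => c * f x) = fun x => c * xGrad f x := by
  ext x
  simp only [xGrad, pd_const_mul hf, mul_sum]
  exact sum_congr rfl fun j _ => by ring

theorem xGrad_sub {f g : Euc d → ℂ} (hf : Differentiable ℝ f) (hg : Differentiable ℝ g) :
    xGrad (fun x => f x - g x) = fun x => xGrad f x - xGrad g x := by
  ext x
  simp only [xGrad, pd_sub hf hg, ← sum_sub_distrib]
  exact sum_congr rfl fun j _ => by ring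

theorem xGrad_sum {ι : Type*} (s : Finset ι) {f : ι → Euc d → ℂ}
    (hf : ∀ i, Differentiable ℝ (f i)) :
    xGrad (fun x => ∑ i ∈ s, f i x) = fun x => ∑ i ∈ s, xGrad (f i) x := by
  ext x
  simp only [xGrad, pd_sum s hf, mul_sum]
  exact sum_comm

theorem commCoef_xGrad {f : Euc d → ℂ} (hf : ContDiff ℝ (⊤ : ℕ∞) f) (q : ℕ) :
    xGrad (commCoef q f) = commCoef q (xGrad f) := by
  unfold commCoef
  rw [xGrad_const_mul ((contDiff_const.mul hf).sub hf.xGrad).differentiable_top,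
    xGrad_sub (contDiff_const.mul hf).differentiable_top hf.xGrad.differentiable_top,
    xGrad_const_mul hf.differentiable_top]

theorem pdList_append (l l' : List (Fin d)) (u : Euc d → ℂ) :
    pdList (l ++ l') u = pdList l' (pdList l u) := by
  induction l generalizing u with
  | nil => rfl
  | cons j l ih => exact ih _

theorem pdList_replicate (m : ℕ) (j : Fin d) (u : Euc d → ℂ) :
    pdList (List.replicate m j) u = (pd j)^[m] u := by
  induction m generalizing u with
  | zero => rfl
  | succ m ih => exact ih _

theorem pdList_perm {l l' : List (Fin d)} (h : l.Perm l') {u : Euc d → ℂ}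
    (hu : ContDiff ℝ (⊤ : ℕ∞) u) : pdList l u = pdList l' u := by
  induction h generalizing u with
  | nil => rfl
  | cons j _ ih => exact ih (hu.pd j)
  | swap i j l => simp only [pdList, pd_comm hu i j]
  | trans _ _ ih₁ ih₂ => exact (ih₁ hu).trans (ih₂ hu)

theorem pdList_add (l : List (Fin d)) {f g : Euc d → ℂ} (hf : ContDiff ℝ (⊤ : ℕ∞) f)
    (hg : ContDiff ℝ (⊤ : ℕ∞) g) :
    pdList l (fun x => f x + g x) = fun x => pdList l f x + pdList l g x := by
  induction l generalizing f g with
  | nil => rfl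
  | cons j l ih =>
    simp only [pdList]
    rw [pd_add hf.differentiable_top hg.differentiable_top, ih (hf.pd j) (hg.pd j)]

theorem pdList_const_mul (l : List (Fin d)) {f : Euc d → ℂ} (hf : ContDiff ℝ (⊤ : ℕ∞) f)
    (c : ℂ) : pdList l (fun x => c * f x) = fun x => c * pdList l f x := by
  induction l generalizing f with
  | nil => rfl
  | cons j l ih =>
    simp only [pdList]
    rw [pd_const_mul hf.differentiable_top, ih (hf.pd j)]

theorem pdList_sub (l : List (Fin d)) {f g : Euc d → ℂ} (hf : ContDiff ℝ (⊤ : ℕ∞) f)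
    (hg : ContDiff ℝ (⊤ : ℕ∞) g) :
    pdList l (fun x => f x - g x) = fun x => pdList l f x - pdList l g x := by
  induction l generalizing f g with
  | nil => rfl
  | cons j l ih =>
    simp only [pdList]
    rw [pd_sub hf.differentiable_top hg.differentiable_top, ih (hf.pd j) (hg.pd j)]

theorem pdList_sum {ι : Type*} (s : Finset ι) (l : List (Fin d)) {f : ι → Euc d → ℂ}
    (hf : ∀ i, ContDiff ℝ (⊤ : ℕ∞) (f i)) :
    pdList l (fun x => ∑ i ∈ s, f i x) = fun x => ∑ i ∈ s, pdList l (f i) x := by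
  induction l generalizing f with
  | nil => rfl
  | cons j l ih =>
    simp only [pdList]
    rw [pd_sum s (fun i => (hf i).differentiable_top), ih (fun i => (hf i).pd j)]

theorem pdList_aop (l : List (Fin d)) {f : Euc d → ℂ} (hf : ContDiff ℝ (⊤ : ℕ∞) f) :
    pdList l (Aop f) = fun x => Aop (pdList l f) x + -Complex.I * l.length * pdList l f x := by
  induction l generalizing f with
  | nil => simp [pdList]
  | cons j l ih =>
    simp only [pdList]
    rw [pd_aop hf, pdList_add l (hf.pd j).aop (contDiff_const.mul (hf.pd j)), ih (hf.pd j),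
      pdList_const_mul l (hf.pd j)]
    ext x
    simp only [List.length_cons]
    push_cast
    ring

theorem pdAlpha_eq_pdList (α : Fin d → ℕ) :
    ∃ l : List (Fin d), (∀ i, l.count i = α i) ∧ ∀ u : Euc d → ℂ, pdAlpha α u = pdList l u := by
  have key : ∀ js : List (Fin d), js.Nodup → ∃ l : List (Fin d),
      (∀ i, l.count i = if i ∈ js then α i else 0) ∧
      ∀ u : Euc d → ℂ, js.foldr (fun j v => (pd j)^[α j] v) u = pdList l u := by
    intro js hjs
    induction js with
    | nil => exact ⟨[], by simp, fun u => rfl⟩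
    | cons j js ih =>
      obtain ⟨l, hl, hlu⟩ := ih hjs.of_cons
      refine ⟨l ++ List.replicate (α j) j, fun i => ?_, fun u => ?_⟩
      · rw [List.count_append, hl, List.count_replicate]
        by_cases hij : i = j
        · subst hij
          simp [(List.nodup_cons.1 hjs).1]
        · simp [hij, Ne.symm hij]
      · rw [pdList_append, pdList_replicate, List.foldr_cons, hlu]
  obtain ⟨l, hl, hlu⟩ := key _ (List.nodup_finRange d)
  exact ⟨l, by simpa using hl, hlu⟩

theorem sum_count_eq_length (l : List (Fin d)) : ∑ i, l.count i = l.length := by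
  have := Multiset.sum_count_eq_card (s := Finset.univ) (m := (l : Multiset (Fin d))) (by simp)
  simpa using this

theorem mem_multiIndices {r : ℕ} {α : Fin d → ℕ} :
    α ∈ multiIndices d r ↔ ∑ i, α i ≤ r := by
  simp only [multiIndices, mem_filter, Fintype.mem_piFinset, Finset.mem_range, and_iff_right_iff_imp]
  intro h i
  exact Nat.lt_succ_of_le ((single_le_sum (fun _ _ => Nat.zero_le _) (mem_univ i)).trans h)

theorem pdList_eq_pdAlpha (l : List (Fin d)) {u : Euc d → ℂ} (hu : ContDiff ℝ (⊤ : ℕ∞) u) :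
    pdList l u = pdAlpha (fun i => l.count i) u := by
  obtain ⟨l', hl', h⟩ := pdAlpha_eq_pdList (fun i : Fin d => l.count i)
  rw [h]
  exact pdList_perm (List.perm_iff_count.2 fun i => (hl' i).symm) hu

theorem eLpNorm_pdList_le_sobNorm (l : List (Fin d)) {m : ℕ} (hl : l.length ≤ m)
    {u : Euc d → ℂ} (hu : ContDiff ℝ (⊤ : ℕ∞) u) :
    eLpNorm (pdList l u) 2 volume ≤ sobNorm d m u := by
  rw [pdList_eq_pdAlpha l hu]
  exact single_le_sum (f := fun α => eLpNorm (pdAlpha α u) 2 volume) (fun _ _ => zero_le)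
    (mem_multiIndices.2 (by rwa [sum_count_eq_length]))

theorem ContDiff.iterate_xGrad {f : Euc d → ℂ} (hf : ContDiff ℝ (⊤ : ℕ∞) f) (n : ℕ) :
    ContDiff ℝ (⊤ : ℕ∞) ((_root_.xGrad)^[n] f) := by
  induction n generalizing f with
  | zero => exact hf
  | succ n ih => exact ih hf.xGrad

theorem eLpNorm_pdList_le_coefNorm (l : List (Fin d)) {o r N i : ℕ} (hl : l.length ≤ r)
    (hi : i ≤ N) {c : Euc d → ℂ} (hc : ContDiff ℝ (⊤ : ℕ∞) c) :
    eLpNorm (pdList l (xGrad^[i] c)) ((d : ℝ≥0∞) / ((o + l.length : ℕ) : ℝ≥0∞)) volume ≤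
      coefNorm d o r N c := by
  rw [pdList_eq_pdAlpha l (hc.iterate_xGrad i), ← sum_count_eq_length]
  refine le_trans ?_ (single_le_sum
    (f := fun n => ∑ α ∈ multiIndices d r, eLpNorm (pdAlpha α ((xGrad (d := d))^[n] c))
      ((d : ℝ≥0∞) / ((o + ∑ i, α i : ℕ) : ℝ≥0∞)) volume) (fun _ _ => zero_le)
    (mem_range.2 (Nat.lt_succ_of_le hi)))
  exact single_le_sum (f := fun α => eLpNorm (pdAlpha α (xGrad^[i] c))
      ((d : ℝ≥0∞) / ((o + ∑ i, α i : ℕ) : ℝ≥0∞)) volume) (fun _ _ => zero_le)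
    (mem_multiIndices.2 (by rwa [sum_count_eq_length]))

/-- Iterated commutators of a linear differential operator with the generator of dilations. -/
theorem adA_apply {ι : Type*} (s : Finset ι) (z : ι → ℂ) (c : ι → Euc d → ℂ)
    (m : ι → List (Fin d)) (hc : ∀ i, ContDiff ℝ (⊤ : ℕ∞) (c i))
    (T : (Euc d → ℂ) → (Euc d → ℂ))
    (hT : ∀ v, ContDiff ℝ (⊤ : ℕ∞) v → T v = fun x => ∑ i ∈ s, z i * (c i x * pdList (m i) v x))
    (n : ℕ) {u : Euc d → ℂ} (hu : ContDiff ℝ (⊤ : ℕ∞) u) :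
    adA n T u = fun x =>
      ∑ i ∈ s, z i * ((commCoef (m i).length)^[n] (c i) x * pdList (m i) u x) := by
  induction n generalizing u with
  | zero => exact hT u hu
  | succ n ih =>
    have hcn := fun i => (hc i).iterate_commCoef (m i).length n
    have hp := fun i => (hcn i).mul (hu.pdList (m i))
    ext x
    simp only [adA]
    rw [ih hu.aop, ih hu]
    unfold Aop
    rw [xGrad_sum s fun i => (contDiff_const.mul (hp i)).differentiable_top]
    simp only [xGrad_const_mul (hp _).differentiable_top,
      xGrad_mul (hcn _).differentiable_top (hu.pdList _).differentiable_top]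
    rw [mul_sum, mul_sum, ← sum_add_distrib, ← sum_sub_distrib]
    refine sum_congr rfl fun i _ => ?_
    have := congrFun (pdList_aop (m i) hu) x
    unfold Aop at this
    rw [this, Function.iterate_succ_apply']
    simp only [commCoef]
    ring

end Calculus

section Estimates

variable {d : ℕ}

theorem exists_cutoff (d : ℕ) : ∃ (M : ℝ) (χ : ℕ → Euc d → ℝ), 0 ≤ M ∧
    (∀ n, ContDiff ℝ 1 (χ n)) ∧ (∀ n, HasCompactSupport (χ n)) ∧ (∀ n x, |χ n x| ≤ 1) ∧
    (∀ n x, ‖fderiv ℝ (χ n) x‖ ≤ M) ∧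
    ∀ x, ∀ᶠ n in Filter.atTop, χ n x = 1 := by
  let φ : ContDiffBump (0 : Euc d) := ⟨1, 2, one_pos, one_lt_two⟩
  have hφ : ContDiff ℝ 1 φ := φ.contDiff
  obtain ⟨M, hM⟩ := (hφ.continuous_fderiv one_ne_zero).bounded_above_of_compact_support
    (φ.hasCompactSupport.fderiv ℝ)
  have hM0 : 0 ≤ M := (norm_nonneg _).trans (hM 0)
  have hpos : ∀ n : ℕ, (0 : ℝ) < ((n : ℝ) + 1)⁻¹ := fun n => by positivity
  refine ⟨M, fun n x => φ (((n : ℝ) + 1)⁻¹ • x), hM0,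
    fun n => hφ.comp (contDiff_const_smul _), fun n => ?_, fun n x => ?_, fun n x => ?_,
    fun x => ?_⟩
  · exact φ.hasCompactSupport.comp_homeomorph (Homeomorph.smulOfNeZero _ (hpos n).ne')
  · rw [abs_of_nonneg φ.nonneg]
    exact φ.le_one
  · rw [fderiv_comp_smul, norm_smul, Real.norm_eq_abs, abs_of_pos (hpos n)]
    refine (mul_le_of_le_one_left (norm_nonneg _) ?_).trans (hM _)
    exact inv_le_one_of_one_le₀ (by linarith [n.cast_nonneg (α := ℝ)])
  · filter_upwards [Filter.eventually_ge_atTop ⌈‖x‖⌉₊] with n hn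
    apply φ.one_of_mem_closedBall
    rw [mem_closedBall_zero_iff, norm_smul, Real.norm_eq_abs, abs_of_pos (hpos n),
      inv_mul_le_iff₀ (by positivity)]
    have := Nat.ceil_le.1 hn
    show ‖x‖ ≤ (n + 1) * 1
    linarith

theorem norm_fderiv_le_sum (f : Euc d → ℂ) (x : Euc d) :
    ‖fderiv ℝ f x‖ ≤ ∑ j, ‖pd j f x‖ := by
  refine ContinuousLinearMap.opNorm_le_bound _ (sum_nonneg fun _ _ => norm_nonneg _) fun y => ?_
  have hy : y = ∑ j, y j • EuclideanSpace.single j (1 : ℝ) := by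
    ext i
    simp [Finset.sum_apply, Pi.single_apply]
  conv_lhs => rw [hy]
  rw [map_sum, sum_mul]
  refine (norm_sum_le _ _).trans (sum_le_sum fun j _ => ?_)
  rw [map_smul, norm_smul, mul_comm]
  exact mul_le_mul_of_nonneg_left (PiLp.norm_apply_le y j) (norm_nonneg _)

/-- The inhomogeneous Sobolev inequality `W^{1,p} ⊆ L^{p'}`, without any support condition. -/
theorem exists_sobolev_step (hd : 0 < d) {p p' : ℝ≥0∞} (hp : 1 ≤ p) (hpt : p ≠ ⊤) (hpt' : p' ≠ ⊤)
    (h : p'.toReal⁻¹ = p.toReal⁻¹ - (d : ℝ)⁻¹) :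
    ∃ C : NNReal, ∀ f : Euc d → ℂ, ContDiff ℝ 1 f →
      eLpNorm f p' volume ≤ C * (eLpNorm f p volume + ∑ j, eLpNorm (pd j f) p volume) := by
  lift p to NNReal using hpt
  lift p' to NNReal using hpt'
  obtain ⟨M, χ, hM, hχ, hχc, hχ1, hχM, hχlim⟩ := exists_cutoff d
  let K : NNReal := SNormLESNormFDerivOfEqConst ℂ (volume : Measure (Euc d)) p
  let M' : NNReal := ⟨max M 1, by positivity⟩
  refine ⟨K * M', fun f hf => ?_⟩
  have hfin : Module.finrank ℝ (Euc d) = d := finrank_euclideanSpace_fin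
  have hmeas : ∀ j, AEStronglyMeasurable (pd j f) volume := fun j =>
    ((hf.continuous_fderiv one_ne_zero).clm_apply continuous_const).aestronglyMeasurable
  have hpd : ∀ n, ContDiff ℝ 1 (fun x => χ n x • f x) := fun n => (hχ n).smul hf
  have hbound : ∀ n, eLpNorm (fun x => χ n x • f x) p' volume ≤
      (K * M' : NNReal) * (eLpNorm f p volume + ∑ j, eLpNorm (pd j f) p volume) := by
    intro n
    refine (eLpNorm_le_eLpNorm_fderiv_of_eq volume (hpd n) ((hχc n).smul_right)
      (by exact_mod_cast hp) (by rwa [hfin]) (by simpa [hfin] using h)).trans ?_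
    rw [ENNReal.coe_mul, mul_assoc]
    refine mul_le_mul_right ?_ _
    have hle : ∀ x, ‖fderiv ℝ (fun x => χ n x • f x) x‖ ≤
        M' * ‖‖f x‖ + ∑ j, ‖pd j f x‖‖ := by
      intro x
      have hs : 0 ≤ ∑ j, ‖pd j f x‖ := sum_nonneg fun _ _ => norm_nonneg _
      have hM1 : M ≤ M' := le_max_left _ _
      have hM2 : (1 : ℝ) ≤ M' := le_max_right _ _
      rw [fderiv_fun_smul ((hχ n).differentiable one_ne_zero x) (hf.differentiable one_ne_zero x),
        Real.norm_of_nonneg (add_nonneg (norm_nonneg _) hs)]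
      refine (norm_add_le _ _).trans ?_
      rw [norm_smul, ContinuousLinearMap.norm_smulRight_apply, mul_add, add_comm]
      refine add_le_add ?_ ?_
      · exact mul_le_mul_of_nonneg_right ((hχM n x).trans hM1) (norm_nonneg _)
      · exact mul_le_mul ((hχ1 n x).trans hM2) (norm_fderiv_le_sum f x) (norm_nonneg _)
          (zero_le_one.trans hM2)
    refine (eLpNorm_le_mul_eLpNorm_of_ae_le_mul (Filter.Eventually.of_forall hle) _).trans ?_
    rw [ENNReal.ofReal_coe_nnreal]
    refine mul_le_mul_right ?_ _
    have h1 : (fun x => ‖f x‖ + ∑ j, ‖pd j f x‖) =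
        (fun x => ‖f x‖) + ∑ j, fun x => ‖pd j f x‖ := by
      ext x; simp
    rw [h1]
    refine (eLpNorm_add_le hf.continuous.aestronglyMeasurable.norm
      (Finset.aestronglyMeasurable_sum _ fun j _ => (hmeas j).norm) hp).trans ?_
    rw [eLpNorm_norm]
    refine add_le_add le_rfl ((eLpNorm_sum_le (fun j _ => (hmeas j).norm) hp).trans ?_)
    simp only [eLpNorm_norm, le_refl]
  refine (Lp.eLpNorm_lim_le_liminf_eLpNorm (f := fun n x => χ n x • f x)
    (fun n => (hpd n).continuous.aestronglyMeasurable) f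
    (Filter.Eventually.of_forall fun x => ?_)).trans ?_
  · refine tendsto_const_nhds.congr' ?_
    filter_upwards [hχlim x] with n hn
    rw [hn, one_smul]
  · exact (Filter.liminf_le_liminf (Filter.Eventually.of_forall hbound)).trans_eq
      (Filter.liminf_const _)

/-- The Sobolev exponent `1/p = 1/2 - k/d`. -/
def sobExp (d k : ℕ) : ℝ≥0∞ := ENNReal.ofReal ((1 / 2 - (k : ℝ) / d)⁻¹)

theorem half_sub_div_pos {k : ℕ} (hk : 2 * k < d) : 0 < 1 / 2 - (k : ℝ) / d := by
  have hd : (0 : ℝ) < d := by exact_mod_cast (by omega : 0 < d)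
  have : 2 * (k : ℝ) < d := by exact_mod_cast hk
  rw [sub_pos, div_lt_iff₀ hd]
  linarith

theorem exists_sobolev {k : ℕ} (hk : 2 * k < d) :
    ∃ C : NNReal, ∀ f : Euc d → ℂ, ContDiff ℝ (⊤ : ℕ∞) f → ∀ M : ℝ≥0∞,
      (∀ l : List (Fin d), l.length ≤ k → eLpNorm (pdList l f) 2 volume ≤ M) →
      eLpNorm f (sobExp d k) volume ≤ C * M := by
  induction k with
  | zero =>
    refine ⟨1, fun f _ M h => ?_⟩
    have : sobExp d 0 = 2 := by simp [sobExp]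
    rw [this, ENNReal.coe_one, one_mul]
    exact h [] le_rfl
  | succ k ih =>
    obtain ⟨C, hC⟩ := ih (by omega)
    have h1 := half_sub_div_pos (d := d) (k := k) (by omega)
    have h2 := half_sub_div_pos hk
    have hd : 0 < d := by omega
    obtain ⟨C', hC'⟩ := exists_sobolev_step (d := d) hd (p := sobExp d k) (p' := sobExp d (k + 1))
      (by
        rw [sobExp, ENNReal.one_le_ofReal]
        refine (one_le_inv₀ h1).2 ?_
        have : 0 ≤ (k : ℝ) / d := by positivity
        linarith) ENNReal.ofReal_ne_top ENNReal.ofReal_ne_top (by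
        rw [sobExp, sobExp, ENNReal.toReal_ofReal (inv_nonneg.2 h1.le),
          ENNReal.toReal_ofReal (inv_nonneg.2 h2.le), inv_inv, inv_inv]
        push_cast
        ring)
    refine ⟨C' * (C + d * C), fun f hf M h => (hC' f (hf.of_le (by simp))).trans ?_⟩
    push_cast
    rw [mul_assoc]
    refine mul_le_mul_right ?_ _
    rw [add_mul]
    refine add_le_add (hC f hf M fun l hl => h l (by omega)) ?_
    refine (sum_le_card_nsmul univ _ (C * M) fun j _ => ?_).trans ?_
    · exact hC (pd j f) (hf.pd j) M fun l hl => h (j :: l) (by simpa using hl)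
    · simp [mul_assoc]

theorem eLpNorm_pdList_mul_le (l : List (Fin d)) {c g : Euc d → ℂ}
    (hc : ContDiff ℝ (⊤ : ℕ∞) c) (hg : ContDiff ℝ (⊤ : ℕ∞) g) {M : ℝ≥0∞}
    (h : ∀ l₁ l₂ : List (Fin d), l₁.length + l₂.length = l.length →
      eLpNorm (fun x => pdList l₁ c x * pdList l₂ g x) 2 volume ≤ M) :
    eLpNorm (pdList l (fun x => c x * g x)) 2 volume ≤ 2 ^ l.length * M := by
  induction l generalizing c g with
  | nil => simpa [pdList] using h [] [] rfl
  | cons j l ih =>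
    simp only [pdList]
    have h₁ := (hc.pd j).mul hg
    have h₂ := hc.mul (hg.pd j)
    rw [pd_mul hc.differentiable_top hg.differentiable_top, pdList_add l h₁ h₂]
    refine (eLpNorm_add_le (h₁.pdList l).continuous.aestronglyMeasurable
      (h₂.pdList l).continuous.aestronglyMeasurable (by norm_num)).trans ?_
    rw [List.length_cons, pow_succ, mul_two, add_mul]
    refine add_le_add (ih (hc.pd j) hg fun l₁ l₂ hl => ?_) (ih hc (hg.pd j) fun l₁ l₂ hl => ?_)
    · exact h (j :: l₁) l₂ (by simp only [List.length_cons]; omega)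
    · exact h l₁ (j :: l₂) (by simp only [List.length_cons]; omega)

theorem eLpNorm_iterate_commCoef_le (q n : ℕ) (l : List (Fin d)) {p : ℝ≥0∞} (hp : 1 ≤ p)
    {c : Euc d → ℂ} (hc : ContDiff ℝ (⊤ : ℕ∞) c) {K : ℝ≥0∞}
    (hK : ∀ i ≤ n, eLpNorm (pdList l (xGrad^[i] c)) p volume ≤ K) :
    eLpNorm (pdList l ((commCoef q)^[n] c)) p volume ≤ (q + 1) ^ n * K := by
  induction n generalizing c K with
  | zero => simpa using hK 0 le_rfl
  | succ n ih =>
    have hcomm : xGrad ((commCoef q)^[n] c) = (commCoef q)^[n] (xGrad c) := by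
      clear ih hK
      induction n generalizing c with
      | zero => rfl
      | succ n ih =>
        simp only [Function.iterate_succ_apply]
        rw [ih (hc.commCoef q), commCoef_xGrad hc]
    have h₁ := hc.iterate_commCoef q n
    have h₂ := hc.xGrad.iterate_commCoef q n
    have e : pdList l ((commCoef q)^[n + 1] c) = (-Complex.I) •
        ((q : ℂ) • pdList l ((commCoef q)^[n] c) - pdList l ((commCoef q)^[n] (xGrad c))) := by
      rw [Function.iterate_succ_apply']
      have h : commCoef q ((commCoef q)^[n] c) = fun x => -Complex.I *
          ((q : ℂ) * (commCoef q)^[n] c x - xGrad ((commCoef q)^[n] c) x) := rfl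
      rw [h, hcomm, pdList_const_mul l ((contDiff_const.mul h₁).sub h₂),
        pdList_sub l (contDiff_const.mul h₁) h₂, pdList_const_mul l h₁]
      rfl
    rw [e, eLpNorm_const_smul]
    have hI : ‖-Complex.I‖ₑ = 1 := by simp [enorm_eq_nnnorm]
    have hq : ‖(q : ℂ)‖ₑ = q := by simp [enorm_eq_nnnorm]
    rw [hI, one_mul]
    refine (eLpNorm_sub_le ((h₁.pdList l).continuous.aestronglyMeasurable.const_smul _)
      (h₂.pdList l).continuous.aestronglyMeasurable hp).trans ?_
    rw [eLpNorm_const_smul, hq, pow_succ', mul_assoc, add_mul, one_mul]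
    refine add_le_add (mul_le_mul_right (ih hc fun i hi => hK i (by omega)) _)
      (ih hc.xGrad fun i hi => ?_)
    rw [← Function.iterate_succ_apply]
    exact hK (i + 1) (by omega)

theorem eLpNorm_mul_sobExp_le {k : ℕ} (hk : 2 * k < d) {f g : Euc d → ℂ}
    (hf : Continuous f) (hg : Continuous g) :
    eLpNorm (fun x => f x * g x) 2 volume ≤
      eLpNorm f ((d : ℝ≥0∞) / (k : ℝ≥0∞)) volume * eLpNorm g (sobExp d k) volume := by
  have hd : (0 : ℝ) < d := by exact_mod_cast (by omega : 0 < d)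
  have : ENNReal.HolderTriple ((d : ℝ≥0∞) / (k : ℝ≥0∞)) (sobExp d k) 2 := by
    have h1 := half_sub_div_pos hk
    constructor
    rw [ENNReal.inv_div (by simp) (by right; exact_mod_cast (by omega : d ≠ 0)), sobExp,
      ← ENNReal.ofReal_inv_of_pos (inv_pos.2 h1), inv_inv, ← ENNReal.ofReal_natCast k,
      ← ENNReal.ofReal_natCast d, ← ENNReal.ofReal_div_of_pos hd,
      ← ENNReal.ofReal_add (by positivity) h1.le, add_sub_cancel, one_div,
      ENNReal.ofReal_inv_of_pos two_pos]
    simp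
  exact eLpNorm_smul_le_mul_eLpNorm (p := (d : ℝ≥0∞) / (k : ℝ≥0∞)) (q := sobExp d k) (r := 2)
    (f := g) (φ := f) hg.aestronglyMeasurable hf.aestronglyMeasurable

/-- The estimate for a single term `c ∂^β` of the operator, `|β| = q`. -/
theorem exists_term_bound {o q s r : ℕ} (n : ℕ) (hoq : o + q = 2) (ho : o ≤ 1) (hs : 1 ≤ s)
    (hsr : s ≤ r) (hr : 2 * r < d) :
    ∃ C : NNReal, ∀ (c u : Euc d → ℂ) (m l : List (Fin d)), ContDiff ℝ (⊤ : ℕ∞) c →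
      ContDiff ℝ (⊤ : ℕ∞) u → m.length = q → l.length ≤ s - 1 →
      eLpNorm (pdList l (fun x => (commCoef q)^[n] c x * pdList m u x)) 2 volume ≤
        C * coefNorm d o (r - o) n c * sobNorm d (s + 1) u := by
  have hS : ∀ k : ℕ, ∃ C : NNReal, 2 * k < d → ∀ f : Euc d → ℂ, ContDiff ℝ (⊤ : ℕ∞) f →
      ∀ M : ℝ≥0∞, (∀ l : List (Fin d), l.length ≤ k → eLpNorm (pdList l f) 2 volume ≤ M) →
      eLpNorm f (sobExp d k) volume ≤ C * M := by
    intro k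
    by_cases hk : 2 * k < d
    · obtain ⟨C, hC⟩ := exists_sobolev hk
      exact ⟨C, fun _ => hC⟩
    · exact ⟨0, fun h => absurd h hk⟩
  choose C hC using hS
  let C₀ : NNReal := ∑ k ∈ range (s + 1), C k
  refine ⟨2 ^ (s - 1) * ((q + 1) ^ n * C₀), fun c u m l hc hu hm hl => ?_⟩
  have hcn := hc.iterate_commCoef q n
  refine (eLpNorm_pdList_mul_le l hcn (hu.pdList m) (M := ((q + 1) ^ n * C₀) *
    coefNorm d o (r - o) n c * sobNorm d (s + 1) u) fun l₁ l₂ hl₁₂ => ?_).trans ?_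
  · have hk : 2 * (o + l₁.length) < d := by omega
    have hd0 : (d : ℝ≥0∞) ≠ 0 := by exact_mod_cast (by omega : d ≠ 0)
    refine (eLpNorm_mul_sobExp_le hk (hcn.pdList l₁).continuous
      ((hu.pdList m).pdList l₂).continuous).trans ?_
    have h1 := eLpNorm_iterate_commCoef_le q n l₁
      (p := (d : ℝ≥0∞) / ((o + l₁.length : ℕ) : ℝ≥0∞)) (by
        rw [ENNReal.le_div_iff_mul_le (Or.inr hd0) (Or.inl (by simp)), one_mul]
        exact_mod_cast (by omega : o + l₁.length ≤ d)) hc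
      (fun i hi => eLpNorm_pdList_le_coefNorm l₁ (o := o) (r := r - o) (by omega) hi hc)
    have h2 := hC (o + l₁.length) hk (pdList l₂ (pdList m u)) ((hu.pdList m).pdList l₂)
      (sobNorm d (s + 1) u) fun l' hl' => by
        rw [← pdList_append, ← pdList_append]
        exact eLpNorm_pdList_le_sobNorm _ (by simp only [List.length_append]; omega) hu
    have h3 : C (o + l₁.length) ≤ C₀ :=
      single_le_sum (f := C) (fun _ _ => zero_le) (mem_range.2 (by omega))
    calc _ ≤ ((q + 1) ^ n * coefNorm d o (r - o) n c) * (C₀ * sobNorm d (s + 1) u) :=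
          mul_le_mul' h1 (h2.trans (mul_le_mul_left (ENNReal.coe_le_coe.2 h3) _))
      _ = _ := by ring
  · push_cast
    rw [mul_assoc, mul_assoc, mul_assoc, mul_assoc]
    refine mul_le_mul' (pow_le_pow_right₀ (by norm_num) hl) (le_of_eq ?_)
    ring

end Estimates

theorem eLpNorm_const_mul_of_norm_one {d : ℕ} {z : ℂ} (hz : ‖z‖ = 1) (f : Euc d → ℂ) (p : ℝ≥0∞) :
    eLpNorm (fun x => z * f x) p volume = eLpNorm f p volume := by
  have h := eLpNorm_const_smul z f p volume
  rw [← ofReal_norm, hz, ENNReal.ofReal_one, one_mul] at h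
  exact h

theorem sobNorm_sum_le {d : ℕ} {ι : Type*} (s : Finset ι) (z : ι → ℂ) (hz : ∀ i, ‖z i‖ = 1)
    (f : ι → Euc d → ℂ) (hf : ∀ i, ContDiff ℝ (⊤ : ℕ∞) (f i)) (m : ℕ) (K : ι → ℝ≥0∞)
    (hK : ∀ i, ∀ l : List (Fin d), l.length ≤ m → eLpNorm (pdList l (f i)) 2 volume ≤ K i) :
    sobNorm d m (fun x => ∑ i ∈ s, z i * f i x) ≤ (multiIndices d m).card * ∑ i ∈ s, K i := by
  rw [← nsmul_eq_mul]
  refine sum_le_card_nsmul _ _ _ fun α hα => ?_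
  obtain ⟨l, hl, hlu⟩ := pdAlpha_eq_pdList α
  have hlen : l.length ≤ m := by
    rw [← sum_count_eq_length]
    simpa only [hl] using mem_multiIndices.1 hα
  rw [hlu, pdList_sum s l fun i => contDiff_const.mul (hf i)]
  have e : (fun x => ∑ i ∈ s, pdList l (fun y => z i * f i y) x) =
      ∑ i ∈ s, fun x => z i * pdList l (f i) x := by
    ext x
    simp only [pdList_const_mul l (hf _), Finset.sum_apply]
  rw [e]
  refine (eLpNorm_sum_le (fun i _ => (continuous_const.mul
    ((hf i).pdList l).continuous).aestronglyMeasurable) (by norm_num)).trans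
    (sum_le_sum fun i _ => ?_)
  exact (eLpNorm_const_mul_of_norm_one (hz i) _ _).trans_le (hK i l hlen)

theorem pop_add_lap_eq {d : ℕ} (a : Fin d → Fin d → Euc d → ℂ) (b : Fin d → Euc d → ℂ)
    {v : Euc d → ℂ} (hv : ContDiff ℝ (⊤ : ℕ∞) v) (x : Euc d) :
    Pop a b v x + lap v x =
      (∑ j, ∑ k, -1 * ((a j k x - if j = k then 1 else 0) * pdList [k, j] v x)) +
        ∑ k, -Complex.I * (b k x * pdList [k] v x) := by
  have hD : ∀ j k, Dop j (Dop k v) x = -pd j (pd k v) x := by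
    intro j k
    unfold Dop
    rw [pd_const_mul (hv.pd k).differentiable_top, ← mul_assoc, neg_mul_neg, Complex.I_mul_I,
      neg_one_mul]
  have hlap : lap v x = ∑ j, ∑ k, if j = k then pd j (pd k v) x else 0 := by
    simp [lap]
  unfold Pop
  rw [hlap, add_right_comm, ← sum_add_distrib]
  congr 1
  · refine sum_congr rfl fun j _ => ?_
    rw [← sum_add_distrib]
    refine sum_congr rfl fun k _ => ?_
    rw [hD]
    simp only [pdList]
    split_ifs <;> ring
  · refine sum_congr rfl fun k _ => ?_
    simp only [pdList, Dop]
    ring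

/-- With `r = r̄(d)`, for integers `n ≥ 0` and `1 ≤ s ≤ r`:
`‖ad_A^n (P + Δ) u‖_{H^{s-1}} ≤ C (Σ_{j,k} ‖a_{jk} - δ_{jk}‖_{0,r,n} + Σ_k ‖b_k‖_{1,r-1,n}) ‖u‖_{H^{s+1}}`. -/
theorem statement12 (d : ℕ) (hd : 3 ≤ d) (n s : ℕ) (hs1 : 1 ≤ s) (hs : s ≤ rbar d) :
    ∃ C : ℝ, 0 < C ∧
      ∀ (a : Fin d → Fin d → Euc d → ℂ) (b : Fin d → Euc d → ℂ),
        (∀ j k, ContDiff ℝ (⊤ : ℕ∞) (a j k)) → (∀ k, ContDiff ℝ (⊤ : ℕ∞) (b k)) →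
        (∀ j k, coefNorm d 0 (rbar d) n (fun x => a j k x - if j = k then 1 else 0) ≠ ⊤) →
        (∀ k, coefNorm d 1 (rbar d - 1) n (b k) ≠ ⊤) →
        ∀ u : SchwartzMap (Euc d) ℂ,
          sobNorm d (s - 1) (adA n (fun v x => Pop a b v x + lap v x) ⇑u) ≤
            ENNReal.ofReal C *
              ((∑ j : Fin d, ∑ k : Fin d,
                  coefNorm d 0 (rbar d) n (fun x => a j k x - if j = k then 1 else 0)) +
                ∑ k : Fin d, coefNorm d 1 (rbar d - 1) n (b k)) *
              sobNorm d (s + 1) ⇑u := by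
  have hr : 2 * rbar d < d := by unfold rbar; omega
  obtain ⟨C₁, hC₁⟩ := exists_term_bound (d := d) (o := 0) (q := 2) n rfl (by norm_num) hs1 hs hr
  obtain ⟨C₂, hC₂⟩ := exists_term_bound (d := d) (o := 1) (q := 1) n rfl le_rfl hs1 hs hr
  let N : NNReal := (multiIndices d (s - 1)).card
  refine ⟨(N * (C₁ + C₂) + 1 : NNReal), by positivity, fun a b ha hb _ _ u => ?_⟩
  rw [ENNReal.ofReal_coe_nnreal]
  have hu : ContDiff ℝ (⊤ : ℕ∞) u := u.smooth'
  let z : (Fin d × Fin d) ⊕ Fin d → ℂ := Sum.elim (fun _ => -1) fun _ => -Complex.I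
  let c : (Fin d × Fin d) ⊕ Fin d → Euc d → ℂ :=
    Sum.elim (fun p x => a p.1 p.2 x - if p.1 = p.2 then 1 else 0) b
  let m : (Fin d × Fin d) ⊕ Fin d → List (Fin d) :=
    Sum.elim (fun p => [p.2, p.1]) fun k => [k]
  let K : (Fin d × Fin d) ⊕ Fin d → ℝ≥0∞ :=
    Sum.elim (fun p => coefNorm d 0 (rbar d) n (c (Sum.inl p)))
      fun k => coefNorm d 1 (rbar d - 1) n (b k)
  have hc : ∀ i, ContDiff ℝ (⊤ : ℕ∞) (c i) := by
    rintro (p | k)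
    · exact (ha p.1 p.2).sub contDiff_const
    · exact hb k
  have hz : ∀ i, ‖z i‖ = 1 := by rintro (p | k) <;> simp [z]
  have hT : ∀ v : Euc d → ℂ, ContDiff ℝ (⊤ : ℕ∞) v → (fun x => Pop a b v x + lap v x) =
      fun x => ∑ i, z i * (c i x * pdList (m i) v x) := by
    intro v hv
    ext x
    rw [pop_add_lap_eq a b hv, Fintype.sum_sum_type, Fintype.sum_prod_type]
    rfl
  rw [adA_apply univ z c m hc _ hT n hu]
  refine (sobNorm_sum_le univ z hz _
    (fun i => ((hc i).iterate_commCoef (m i).length n).mul (hu.pdList (m i))) (s - 1)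
    (fun i => (C₁ + C₂) * K i * sobNorm d (s + 1) u) ?_).trans ?_
  · rintro (p | k) l hl
    · refine (hC₁ (c (Sum.inl p)) u (m (Sum.inl p)) l (hc _) hu rfl hl).trans ?_
      exact mul_le_mul_left (mul_le_mul_left le_self_add _) _
    · refine (hC₂ (c (Sum.inr k)) u (m (Sum.inr k)) l (hc _) hu rfl hl).trans ?_
      exact mul_le_mul_left (mul_le_mul_left le_add_self _) _
  · have hK : ∑ i, K i = (∑ j : Fin d, ∑ k : Fin d,
        coefNorm d 0 (rbar d) n (fun x => a j k x - if j = k then 1 else 0)) +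
        ∑ k : Fin d, coefNorm d 1 (rbar d - 1) n (b k) := by
      rw [Fintype.sum_sum_type, Fintype.sum_prod_type]
      rfl
    rw [← hK, ← sum_mul, ← mul_sum, ← mul_assoc, ← mul_assoc]
    refine mul_le_mul_left (mul_le_mul_left ?_ _) _
    push_cast
    exact le_self_add
end
end
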